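/- arXiv:1507.01430 — 2 statements merged into one kernel-verified Lean document; each statement's English description precedes it below -/
import Mathlib

section
/- Given c ∈ ℭ_+ and a sequence γ = (γ_k)_{k∈Λ} with γ_0 = 1 and γ_{−k} = conj(γ_k), the functional (P,Q) ↦ J(P,Q) is convex on the convex set 𝔓̄_{+,∘} × (𝔓̄_+ \ {0}). -/
open MeasureTheory Complex Set

noncomputable section

namespace RCE

/-- The scalar product (k,θ) = Σⱼ kⱼ θⱼ. -/
def dotP (d : ℕ) (k : Fin d → ℤ) (θ : Fin d → ℝ) : ℝ := ∑ j, (k j : ℝ) * θ j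

/-- The d-dimensional torus 𝕋^d = (−π,π]^d. -/
def Td (d : ℕ) : Set (Fin d → ℝ) := Set.univ.pi fun _ => Set.Ioc (-Real.pi) Real.pi

/-- Normalized Lebesgue measure dm = (2π)^{-d} dθ on 𝕋^d. -/
def dm (d : ℕ) : Measure (Fin d → ℝ) :=
  (ENNReal.ofReal ((2 * Real.pi) ^ d))⁻¹ • (volume.restrict (Td d))

/-- Conjugate-symmetric coefficient sequences supported on Λ. -/
def IsCoeff (d : ℕ) (Λ : Finset (Fin d → ℤ)) (p : (Fin d → ℤ) → ℂ) : Prop :=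
  (∀ k, k ∉ Λ → p k = 0) ∧ ∀ k, p (-k) = starRingEnd ℂ (p k)

/-- Evaluation of the (real-valued) trigonometric polynomial
`P(e^{iθ}) = Σ_{k∈Λ} p_k e^{-i(k,θ)}`. -/
def eval (d : ℕ) (Λ : Finset (Fin d → ℤ)) (p : (Fin d → ℤ) → ℂ) (θ : Fin d → ℝ) : ℝ :=
  (∑ k ∈ Λ, p k * Complex.exp (-(dotP d k θ : ℂ) * Complex.I)).re

/-- `𝔓̄₊` : the closed cone of nonnegative trigonometric polynomials. -/
def Pbar (d : ℕ) (Λ : Finset (Fin d → ℤ)) : Set ((Fin d → ℤ) → ℂ) :=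
  {p | IsCoeff d Λ p ∧ ∀ θ ∈ Td d, 0 ≤ eval d Λ p θ}

/-- `𝔓₊` : the open cone of positive trigonometric polynomials. -/
def Pplus (d : ℕ) (Λ : Finset (Fin d → ℤ)) : Set ((Fin d → ℤ) → ℂ) :=
  {p | IsCoeff d Λ p ∧ ∀ θ ∈ Td d, 0 < eval d Λ p θ}

/-- The pairing ⟨c,p⟩ = Σ_{k∈Λ} c_k conj(p_k) (real-valued by conjugate symmetry). -/
def pair (d : ℕ) (Λ : Finset (Fin d → ℤ)) (c p : (Fin d → ℤ) → ℂ) : ℝ :=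
  (∑ k ∈ Λ, c k * starRingEnd ℂ (p k)).re

/-- `ℭ₊` : the interior of the dual cone. -/
def Cplus (d : ℕ) (Λ : Finset (Fin d → ℤ)) : Set ((Fin d → ℤ) → ℂ) :=
  {c | IsCoeff d Λ c ∧ ∀ p ∈ Pbar d Λ, p ≠ 0 → 0 < pair d Λ c p}

/-- `ℭ̄₊` : the closed dual cone. -/
def Cbar (d : ℕ) (Λ : Finset (Fin d → ℤ)) : Set ((Fin d → ℤ) → ℂ) :=
  {c | IsCoeff d Λ c ∧ ∀ p ∈ Pbar d Λ, 0 ≤ pair d Λ c p}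

/-- The dual functional J_P(Q) = ⟨c,q⟩ − ∫ P log Q dm. -/
def J (d : ℕ) (Λ : Finset (Fin d → ℤ)) (c P Q : (Fin d → ℤ) → ℂ) : ℝ :=
  pair d Λ c Q - ∫ θ, eval d Λ P θ * Real.log (eval d Λ Q θ) ∂(dm d)

/-- Covariance matching for an absolutely continuous measure Φ dm:
`c_k = ∫ e^{i(k,θ)} Φ(θ) dm(θ)` for all k ∈ Λ. -/
def Matches (d : ℕ) (Λ : Finset (Fin d → ℤ)) (c : (Fin d → ℤ) → ℂ)
    (Φ : (Fin d → ℝ) → ℝ) : Prop :=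
  ∀ k ∈ Λ, c k = ∫ θ, Complex.exp ((dotP d k θ : ℂ) * Complex.I) * (Φ θ : ℂ) ∂(dm d)

/-- `𝔓̄₊,∘` : nonnegative trigonometric polynomials normalized by p₀ = 1. -/
def Pbaro (d : ℕ) (Λ : Finset (Fin d → ℤ)) : Set ((Fin d → ℤ) → ℂ) :=
  {p | p ∈ Pbar d Λ ∧ p 0 = 1}

/-- `𝔓₊,∘` : positive trigonometric polynomials normalized by p₀ = 1. -/
def Ppluso (d : ℕ) (Λ : Finset (Fin d → ℤ)) : Set ((Fin d → ℤ) → ℂ) :=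
  {p | p ∈ Pplus d Λ ∧ p 0 = 1}

/-- The functional J(P,Q) = ⟨c,q⟩ − ⟨γ,p⟩ + ∫ P log(P/Q) dm, with the convention
P log(P/Q) := 0 where P = 0. -/
def J2 (d : ℕ) (Λ : Finset (Fin d → ℤ)) (c γ P Q : (Fin d → ℤ) → ℂ) : ℝ :=
  pair d Λ c Q - pair d Λ γ P +
    ∫ θ, (if eval d Λ P θ = 0 then 0
          else eval d Λ P θ * Real.log (eval d Λ P θ / eval d Λ Q θ)) ∂(dm d)

/-- `|log ‖z‖|` with the value `∞` at `z = 0`. -/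
def absLogNorm (z : ℂ) : ENNReal :=
  if z = 0 then ⊤ else ENNReal.ofReal |Real.log ‖z‖|

lemma measurable_absLogNorm : Measurable absLogNorm :=
  Measurable.ite (measurableSet_singleton 0) measurable_const (by fun_prop)

lemma absLogNorm_mul_of_norm_eq_one {u : ℂ} (hu : ‖u‖ = 1) (z : ℂ) :
    absLogNorm (u * z) = absLogNorm z := by
  have hu0 : u ≠ 0 := by
    rintro rfl
    simp at hu
  simp [absLogNorm, hu, hu0]

/-- Quantitative log-integrability of a polynomial on the unit circle, from Jensen's formula. -/
lemma lintegral_absLogNorm_polynomial_le (f : Polynomial ℂ) {A δ : ℝ} (hA : 1 ≤ A) (hδ : 0 < δ)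
    (hlead : δ ≤ ‖f.leadingCoeff‖) (hbound : ∀ t, ‖f.eval (circleMap 0 1 t)‖ ≤ A) :
    ∫⁻ t in Ioc 0 (2 * Real.pi), absLogNorm (f.eval (circleMap 0 1 t)) ≤
      ENNReal.ofReal (2 * Real.pi * (2 * Real.log A - Real.log δ)) := by
  have hf : f ≠ 0 := by
    rintro rfl
    simp at hlead
    linarith
  have hpi : 0 ≤ 2 * Real.pi := by positivity
  have hne : ∀ᵐ t ∂volume.restrict (Ioc 0 (2 * Real.pi)), f.eval (circleMap 0 1 t) ≠ 0 := by
    rw [ae_restrict_iff' measurableSet_Ioc, ae_iff]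
    have hinj : (Ioc 0 (2 * Real.pi)).InjOn (circleMap 0 1) := by
      rw [← uIoc_of_le hpi]
      exact injOn_circleMap_of_abs_sub_le one_ne_zero (by simp [abs_of_pos Real.pi_pos])
    have hfin : (Ioc 0 (2 * Real.pi) ∩ circleMap 0 1 ⁻¹' (f.roots.toFinset : Set ℂ)).Finite :=
      Set.Finite.of_finite_image (f.roots.toFinset.finite_toSet.subset
        (by rintro _ ⟨t, ht, rfl⟩; exact ht.2)) (hinj.mono inter_subset_left)
    refine measure_mono_null ?_ (hfin.measure_zero volume)
    intro t ht
    simpa [hf, and_assoc] using ht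
  have hint : IntegrableOn (fun t => Real.log ‖f.eval (circleMap 0 1 t)‖)
      (Ioc 0 (2 * Real.pi)) :=
    (intervalIntegrable_iff_integrableOn_Ioc_of_le hpi).1 f.intervalIntegrable_mahlerMeasure
  have hle : ∀ᵐ t ∂volume.restrict (Ioc 0 (2 * Real.pi)),
      Real.log ‖f.eval (circleMap 0 1 t)‖ ≤ Real.log A := by
    filter_upwards [hne] with t ht
    exact Real.log_le_log (norm_pos_iff.2 ht) (hbound t)
  have hlogA : 0 ≤ Real.log A := Real.log_nonneg hA
  have hint' : IntegrableOn (fun t => 2 * Real.log A - Real.log ‖f.eval (circleMap 0 1 t)‖)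
      (Ioc 0 (2 * Real.pi)) := (integrable_const _).sub hint
  calc ∫⁻ t in Ioc 0 (2 * Real.pi), absLogNorm (f.eval (circleMap 0 1 t))
      ≤ ∫⁻ t in Ioc 0 (2 * Real.pi),
          ENNReal.ofReal (2 * Real.log A - Real.log ‖f.eval (circleMap 0 1 t)‖) := by
        refine lintegral_mono_ae ?_
        filter_upwards [hne, hle] with t ht htA
        rw [absLogNorm, if_neg ht]
        refine ENNReal.ofReal_le_ofReal (abs_le.2 ⟨?_, ?_⟩) <;> linarith
    _ = ENNReal.ofReal (∫ t in Ioc 0 (2 * Real.pi),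
          (2 * Real.log A - Real.log ‖f.eval (circleMap 0 1 t)‖)) := by
        refine (ofReal_integral_eq_lintegral_ofReal hint' ?_).symm
        filter_upwards [hle] with t ht
        simp only [Pi.zero_apply]
        linarith
    _ ≤ _ := by
        refine ENNReal.ofReal_le_ofReal ?_
        rw [integral_sub (integrable_const _) hint]
        have h1 : Real.log δ ≤ f.logMahlerMeasure := by
          rw [f.logMahlerMeasure_eq_log_MahlerMeasure]
          exact Real.log_le_log hδ (hlead.trans f.leadingCoeff_le_mahlerMeasure)
        have h2 : ∫ t in Ioc 0 (2 * Real.pi), Real.log ‖f.eval (circleMap 0 1 t)‖ =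
            2 * Real.pi * f.logMahlerMeasure := by
          rw [f.logMahlerMeasure_def, Real.circleAverage_def, intervalIntegral.integral_of_le hpi,
            smul_eq_mul, mul_inv_cancel_left₀ (by positivity)]
        rw [h2]
        simp [Real.pi_pos.le]
        nlinarith [mul_le_mul_of_nonneg_left h1 hpi]

lemma exists_leadingCoeff_sum_eq {ι : Type*} {s : Finset ι} {b : ι → ℂ} {e : ι → ℕ}
    (he : Set.InjOn e s) {i₀ : ι} (hi₀ : i₀ ∈ s) (hb : b i₀ ≠ 0) :
    ∃ i ∈ s, b i ≠ 0 ∧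
      (∑ k ∈ s, Polynomial.C (b k) * Polynomial.X ^ e k).leadingCoeff = b i := by
  classical
  set f := ∑ k ∈ s, Polynomial.C (b k) * Polynomial.X ^ e k with hf
  have hcoeff : ∀ i ∈ s, f.coeff (e i) = b i := by
    intro i hi
    simp only [hf, Polynomial.finsetSum_coeff, Polynomial.coeff_C_mul, Polynomial.coeff_X_pow]
    rw [Finset.sum_eq_single i]
    · simp
    · intro k hk hki
      have : e i ≠ e k := fun h => hki (he hk hi h.symm)
      simp [this]
    · exact fun h => absurd hi h
  have hf0 : f ≠ 0 := by
    intro h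
    apply hb
    rw [← hcoeff i₀ hi₀, h, Polynomial.coeff_zero]
  have hl : f.leadingCoeff ≠ 0 := Polynomial.leadingCoeff_ne_zero.2 hf0
  have : ∃ i ∈ s, e i = f.natDegree := by
    by_contra! h
    apply hl
    simp only [Polynomial.leadingCoeff, hf, Polynomial.finsetSum_coeff, Polynomial.coeff_C_mul,
      Polynomial.coeff_X_pow]
    refine Finset.sum_eq_zero fun k hk => ?_
    rw [if_neg (fun h' => h k hk (hf ▸ h'.symm)), mul_zero]
  obtain ⟨i, hi, hid⟩ := this
  have h : f.leadingCoeff = b i := by rw [Polynomial.leadingCoeff, ← hid, hcoeff i hi]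
  exact ⟨i, hi, h ▸ hl, h⟩

/-- Kronecker substitution: some integer direction separates the frequencies in `Λ`. -/
lemma exists_injOn_sum_mul {d : ℕ} (Λ : Finset (Fin d → ℤ)) :
    ∃ n : Fin d → ℤ, Set.InjOn (fun k : Fin d → ℤ => ∑ j, k j * n j) Λ := by
  classical
  let D : (Fin d → ℤ) → Polynomial ℤ := fun v => ∑ j, Polynomial.C (v j) * Polynomial.X ^ (j : ℕ)
  have hD : ∀ v, v ≠ 0 → D v ≠ 0 := by
    intro v hv h
    apply hv
    ext j
    have := congrArg (fun p => p.coeff (j : ℕ)) h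
    simpa [D, Polynomial.finsetSum_coeff, Polynomial.coeff_X_pow, Fin.val_inj] using this
  have hprod : ∏ x ∈ Λ.offDiag, D (x.1 - x.2) ≠ 0 := by
    refine Finset.prod_ne_zero_iff.2 fun x hx => hD _ ?_
    exact sub_ne_zero.2 (Finset.mem_offDiag.1 hx).2.2
  obtain ⟨N, hN⟩ : ∃ N, (∏ x ∈ Λ.offDiag, D (x.1 - x.2)).eval N ≠ 0 := by
    by_contra! h
    exact hprod (Polynomial.funext fun r => by simpa using h r)
  refine ⟨fun j => N ^ (j : ℕ), fun k hk l hl hkl => ?_⟩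
  by_contra hne
  rw [Polynomial.eval_prod] at hN
  refine Finset.prod_ne_zero_iff.1 hN (k, l) (Finset.mem_offDiag.2 ⟨hk, hl, hne⟩) ?_
  simp only [D, Polynomial.eval_finsetSum, Polynomial.eval_mul, Polynomial.eval_C,
    Polynomial.eval_pow, Polynomial.eval_X, Pi.sub_apply, sub_mul, Finset.sum_sub_distrib]
  exact sub_eq_zero.2 hkl

/-- The complex exponential sum whose real part is `eval`. -/
def expSum (d : ℕ) (Λ : Finset (Fin d → ℤ)) (q : (Fin d → ℤ) → ℂ) (θ : Fin d → ℝ) : ℂ :=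
  ∑ k ∈ Λ, q k * Complex.exp (-(dotP d k θ : ℂ) * Complex.I)

instance : Fact (0 < 2 * Real.pi) := ⟨Real.two_pi_pos⟩

/-- The function on `(ℝ / 2πℤ)^d` induced by `expSum`. -/
def torusSum (d : ℕ) (Λ : Finset (Fin d → ℤ)) (q : (Fin d → ℤ) → ℂ)
    (x : Fin d → AddCircle (2 * Real.pi)) : ℂ :=
  ∑ k ∈ Λ, q k * ∏ j, fourier (-(k j)) (x j)

lemma continuous_torusSum (d : ℕ) (Λ : Finset (Fin d → ℤ)) (q : (Fin d → ℤ) → ℂ) :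
    Continuous (torusSum d Λ q) := by
  unfold torusSum
  fun_prop

lemma prod_fourier_coe (d : ℕ) (k : Fin d → ℤ) (θ : Fin d → ℝ) :
    ∏ j, fourier (-(k j)) (θ j : AddCircle (2 * Real.pi)) =
      Complex.exp (-(dotP d k θ : ℂ) * Complex.I) := by
  simp_rw [fourier_coe_apply]
  rw [← Complex.exp_sum]
  congr 1
  simp only [dotP]
  push_cast
  rw [← Finset.sum_neg_distrib, Finset.sum_mul]
  refine Finset.sum_congr rfl fun j _ => ?_
  have : (Real.pi : ℂ) ≠ 0 := by exact_mod_cast Real.pi_ne_zero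
  field_simp

lemma torusSum_coe (d : ℕ) (Λ : Finset (Fin d → ℤ)) (q : (Fin d → ℤ) → ℂ) (θ : Fin d → ℝ) :
    torusSum d Λ q (fun j => (θ j : AddCircle (2 * Real.pi))) = expSum d Λ q θ := by
  simp_rw [torusSum, prod_fourier_coe, expSum]

/-- Along a line of direction `n`, `torusSum` is, up to a unimodular factor, a polynomial on the
unit circle. -/
lemma exists_polynomial_torusSum_add {d : ℕ} {Λ : Finset (Fin d → ℤ)} {n : Fin d → ℤ}
    (hn : Set.InjOn (fun k : Fin d → ℤ => ∑ j, k j * n j) Λ) (q : (Fin d → ℤ) → ℂ)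
    {k₀ : Fin d → ℤ} (hk₀ : k₀ ∈ Λ) (hq : q k₀ ≠ 0) (x : Fin d → AddCircle (2 * Real.pi)) :
    ∃ (f : Polynomial ℂ) (M : ℕ), (∃ k ∈ Λ, q k ≠ 0 ∧ ‖f.leadingCoeff‖ = ‖q k‖) ∧
      ∀ t : ℝ, f.eval (circleMap 0 1 t) = circleMap 0 1 t ^ M *
        torusSum d Λ q (x + fun j => (((n j : ℝ) * t : ℝ) : AddCircle (2 * Real.pi))) := by
  set m : (Fin d → ℤ) → ℤ := fun k => ∑ j, k j * n j with hm
  set M : ℕ := ∑ k ∈ Λ, (m k).toNat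
  have hM : ∀ k ∈ Λ, m k ≤ M := fun k hk =>
    (Int.self_le_toNat _).trans (by
      exact_mod_cast Finset.single_le_sum (f := fun k => (m k).toNat) (fun _ _ => Nat.zero_le _) hk)
  set b : (Fin d → ℤ) → ℂ := fun k => q k * ∏ j, fourier (-(k j)) (x j) with hb
  have hbn : ∀ k, ‖b k‖ = ‖q k‖ := by
    intro k
    simp only [hb, norm_mul, norm_prod]
    rw [Finset.prod_eq_one fun j _ => ?_, mul_one]
    rw [fourier_apply]
    exact Circle.norm_coe _
  set e : (Fin d → ℤ) → ℕ := fun k => (M - m k).toNat with he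
  have he' : ∀ k ∈ Λ, (e k : ℤ) = M - m k := fun k hk =>
    Int.toNat_of_nonneg (sub_nonneg.2 (hM k hk))
  have hinj : Set.InjOn e Λ := by
    intro k hk l hl hkl
    refine hn hk hl ?_
    have h1 := he' k hk
    have h2 := he' l hl
    rw [hkl] at h1
    change m k = m l
    linarith
  obtain ⟨k, hk, hbk, hlead⟩ := exists_leadingCoeff_sum_eq (b := b) hinj hk₀
    (by rw [← norm_ne_zero_iff, hbn]; exact norm_ne_zero_iff.2 hq)
  refine ⟨_, M, ⟨k, hk, ?_, by rw [hlead, hbn]⟩, fun t => ?_⟩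
  · rw [← norm_ne_zero_iff, ← hbn]
    exact norm_ne_zero_iff.2 hbk
  · simp only [Polynomial.eval_finsetSum, Polynomial.eval_mul, Polynomial.eval_C,
      Polynomial.eval_pow, Polynomial.eval_X, torusSum, Finset.mul_sum]
    refine Finset.sum_congr rfl fun k hk => ?_
    have h1 : ∀ j, fourier (-(k j)) ((x + fun j => (((n j : ℝ) * t : ℝ) :
        AddCircle (2 * Real.pi))) j) = fourier (-(k j)) (x j) *
          fourier (-(k j)) (((n j : ℝ) * t : ℝ) : AddCircle (2 * Real.pi)) := by
      intro j
      simp only [fourier_apply, Pi.add_apply, zsmul_add, AddCircle.toCircle_add, Circle.coe_mul]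
    simp_rw [h1, Finset.prod_mul_distrib]
    rw [prod_fourier_coe d k fun j => (n j : ℝ) * t]
    have h2 : (dotP d k fun j => (n j : ℝ) * t) = (m k : ℝ) * t := by
      simp only [dotP, hm]
      push_cast
      rw [Finset.sum_mul]
      exact Finset.sum_congr rfl fun j _ => by ring
    have h3 : circleMap 0 1 t ^ e k = circleMap 0 1 t ^ M *
        Complex.exp (-(((m k : ℝ) * t : ℝ) : ℂ) * Complex.I) := by
      simp only [circleMap, Complex.ofReal_one, one_mul, zero_add]
      rw [← Complex.exp_nat_mul, ← Complex.exp_nat_mul, ← Complex.exp_add]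
      congr 1
      have h4 : (e k : ℂ) = (M : ℂ) - (m k : ℂ) := by
        exact_mod_cast congrArg (Int.cast (R := ℂ)) (he' k hk)
      rw [h4]
      push_cast
      ring
    rw [h2, h3]
    simp only [hb]
    ring

lemma norm_torusSum_le (d : ℕ) (Λ : Finset (Fin d → ℤ)) (q : (Fin d → ℤ) → ℂ)
    (x : Fin d → AddCircle (2 * Real.pi)) : ‖torusSum d Λ q x‖ ≤ ∑ k ∈ Λ, ‖q k‖ := by
  refine norm_sum_le_of_le _ fun k _ => ?_
  rw [norm_mul, norm_prod, Finset.prod_eq_one fun j _ => ?_, mul_one]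
  rw [fourier_apply]
  exact Circle.norm_coe _

lemma lintegral_absLogNorm_torusSum_lt_top {d : ℕ} {Λ : Finset (Fin d → ℤ)}
    {q : (Fin d → ℤ) → ℂ} {k₀ : Fin d → ℤ} (hk₀ : k₀ ∈ Λ) (hq : q k₀ ≠ 0) :
    ∫⁻ x, absLogNorm (torusSum d Λ q x) < ⊤ := by
  obtain ⟨n, hn⟩ := exists_injOn_sum_mul Λ
  obtain ⟨k₁, hk₁, hmin⟩ := (Λ.filter fun k => q k ≠ 0).exists_min_image (fun k => ‖q k‖)
    ⟨k₀, Finset.mem_filter.2 ⟨hk₀, hq⟩⟩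
  have hδ : 0 < ‖q k₁‖ := norm_pos_iff.2 (Finset.mem_filter.1 hk₁).2
  set A : ℝ := 1 + ∑ k ∈ Λ, ‖q k‖ with hA
  have hA1 : 1 ≤ A := le_add_of_nonneg_right (Finset.sum_nonneg fun _ _ => norm_nonneg _)
  set C := ENNReal.ofReal (2 * Real.pi * (2 * Real.log A - Real.log ‖q k₁‖))
  let s : ℝ → Fin d → AddCircle (2 * Real.pi) := fun t j => ((n j : ℝ) * t : ℝ)
  have hs : Measurable s := by
    refine measurable_pi_iff.2 fun j => ?_
    exact AddCircle.measurable_mk'.comp (measurable_const.mul measurable_id)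
  have hG : Measurable fun x => absLogNorm (torusSum d Λ q x) :=
    measurable_absLogNorm.comp (continuous_torusSum d Λ q).measurable
  have hline : ∀ x, ∫⁻ t in Ioc 0 (2 * Real.pi), absLogNorm (torusSum d Λ q (x + s t)) ≤ C := by
    intro x
    obtain ⟨f, M, ⟨k, hk, hqk, hlead⟩, hf⟩ := exists_polynomial_torusSum_add hn q hk₀ hq x
    have hu : ∀ t, ‖circleMap 0 1 t ^ M‖ = 1 := fun t => by simp
    have h := lintegral_absLogNorm_polynomial_le f hA1 hδ
      (hlead ▸ hmin k (Finset.mem_filter.2 ⟨hk, hqk⟩)) fun t => by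
        rw [hf, norm_mul, hu, one_mul]
        exact (norm_torusSum_le _ _ _ _).trans (by linarith)
    simpa only [hf, absLogNorm_mul_of_norm_eq_one (hu _)] using h
  have hswap : (∫⁻ x, absLogNorm (torusSum d Λ q x)) * ENNReal.ofReal (2 * Real.pi) ≤
      C * volume (univ : Set (Fin d → AddCircle (2 * Real.pi))) := by
    calc (∫⁻ x, absLogNorm (torusSum d Λ q x)) * ENNReal.ofReal (2 * Real.pi)
        = ∫⁻ t in Ioc 0 (2 * Real.pi), ∫⁻ x, absLogNorm (torusSum d Λ q (x + s t)) := by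
          simp_rw [lintegral_add_right_eq_self (μ := volume)
            (fun x => absLogNorm (torusSum d Λ q x))]
          simp
      _ = ∫⁻ x, ∫⁻ t in Ioc 0 (2 * Real.pi), absLogNorm (torusSum d Λ q (x + s t)) := by
          refine lintegral_lintegral_swap (Measurable.aemeasurable ?_)
          exact hG.comp (measurable_snd.add (hs.comp measurable_fst))
      _ ≤ ∫⁻ _, C := lintegral_mono hline
      _ = _ := lintegral_const C
  have hfin : C * volume (univ : Set (Fin d → AddCircle (2 * Real.pi))) < ⊤ :=
    ENNReal.mul_lt_top ENNReal.ofReal_lt_top (measure_lt_top _ _)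
  refine lt_top_iff_ne_top.2 fun h => ?_
  rw [h, ENNReal.top_mul (by simp [Real.pi_pos])] at hswap
  exact absurd hfin (not_lt.2 hswap)

lemma lintegral_absLogNorm_expSum_lt_top {d : ℕ} {Λ : Finset (Fin d → ℤ)}
    {q : (Fin d → ℤ) → ℂ} {k₀ : Fin d → ℤ} (hk₀ : k₀ ∈ Λ) (hq : q k₀ ≠ 0) :
    ∫⁻ θ in Td d, absLogNorm (expSum d Λ q θ) < ⊤ := by
  have hmp : MeasurePreserving
      (fun (θ : Fin d → ℝ) j => (θ j : AddCircle (2 * Real.pi)))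
      (volume.restrict (Td d)) volume := by
    have h := measurePreserving_pi (ι := Fin d) _ _
      fun _ => AddCircle.measurePreserving_mk (2 * Real.pi) (-Real.pi)
    rw [← Measure.restrict_pi_pi] at h
    rw [show -Real.pi + 2 * Real.pi = Real.pi by ring] at h
    exact h
  have hG : Measurable fun x => absLogNorm (torusSum d Λ q x) :=
    measurable_absLogNorm.comp (continuous_torusSum d Λ q).measurable
  simp_rw [← torusSum_coe]
  rw [hmp.lintegral_comp hG]
  exact lintegral_absLogNorm_torusSum_lt_top hk₀ hq

lemma ofReal_eval {d : ℕ} {Λ : Finset (Fin d → ℤ)} (hΛ : ∀ k ∈ Λ, -k ∈ Λ)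
    {q : (Fin d → ℤ) → ℂ} (hq : IsCoeff d Λ q) (θ : Fin d → ℝ) :
    (eval d Λ q θ : ℂ) = expSum d Λ q θ := by
  refine Complex.conj_eq_iff_re.1 ?_
  rw [map_sum]
  refine Finset.sum_nbij' (fun k => -k) (fun k => -k) hΛ hΛ (fun _ _ => neg_neg _)
    (fun _ _ => neg_neg _) fun k _ => ?_
  have h : dotP d (-k) θ = -dotP d k θ := by simp [dotP]
  rw [map_mul, ← hq.2, h, ← Complex.exp_conj]
  simp

lemma continuous_eval (d : ℕ) (Λ : Finset (Fin d → ℤ)) (q : (Fin d → ℤ) → ℂ) :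
    Continuous (eval d Λ q) := by
  unfold eval dotP
  fun_prop

lemma measurableSet_Td (d : ℕ) : MeasurableSet (Td d) :=
  MeasurableSet.univ_pi fun _ => measurableSet_Ioc

lemma dm_scalar_ne_top (d : ℕ) : (ENNReal.ofReal ((2 * Real.pi) ^ d))⁻¹ ≠ ⊤ := by
  have : 0 < (2 * Real.pi) ^ d := by positivity
  simpa using this

lemma integrable_dm_of_integrableOn {d : ℕ} {f : (Fin d → ℝ) → ℝ} (hf : IntegrableOn f (Td d)) :
    Integrable f (dm d) :=
  hf.smul_measure (dm_scalar_ne_top d)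

lemma ae_dm_of_forall_mem {d : ℕ} {p : (Fin d → ℝ) → Prop} (h : ∀ θ ∈ Td d, p θ) :
    ∀ᵐ θ ∂dm d, p θ :=
  Measure.ae_smul_measure (ae_restrict_of_forall_mem (measurableSet_Td d) h) _

lemma integrableOn_Td_of_continuous {d : ℕ} {f : (Fin d → ℝ) → ℝ} (hf : Continuous f) :
    IntegrableOn f (Td d) := by
  have hK : IsCompact (Set.univ.pi fun _ : Fin d => Icc (-Real.pi) Real.pi) :=
    isCompact_univ_pi fun _ => isCompact_Icc
  exact (hf.continuousOn.integrableOn_compact hK).mono_set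
    (Set.pi_mono fun _ _ => Ioc_subset_Icc_self)

lemma exists_coeff_ne_zero {d : ℕ} {Λ : Finset (Fin d → ℤ)} {q : (Fin d → ℤ) → ℂ}
    (hq : IsCoeff d Λ q) (hq0 : q ≠ 0) : ∃ k ∈ Λ, q k ≠ 0 := by
  obtain ⟨k, hk⟩ := Function.ne_iff.1 hq0
  exact ⟨k, by_contra fun h => hk (hq.1 k h), hk⟩

/-- A nonzero nonnegative trigonometric polynomial is almost everywhere positive. -/
lemma ae_eval_pos {d : ℕ} {Λ : Finset (Fin d → ℤ)} (hΛ : ∀ k ∈ Λ, -k ∈ Λ)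
    {q : (Fin d → ℤ) → ℂ} (hq : q ∈ Pbar d Λ) (hq0 : q ≠ 0) :
    ∀ᵐ θ ∂dm d, 0 < eval d Λ q θ := by
  obtain ⟨k, hk, hqk⟩ := exists_coeff_ne_zero hq.1 hq0
  have hexp : Measurable (expSum d Λ q) := by
    unfold expSum dotP
    fun_prop
  have hae := ae_lt_top (measurable_absLogNorm.comp hexp)
    (lintegral_absLogNorm_expSum_lt_top hk hqk).ne
  filter_upwards [ae_dm_of_forall_mem hq.2, Measure.ae_smul_measure hae _] with θ h1 h2
  refine h1.lt_of_ne fun h => ?_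
  simp [absLogNorm, ← ofReal_eval hΛ hq.1, ← h] at h2

/-- The logarithm of a nonzero nonnegative trigonometric polynomial is integrable. -/
lemma integrable_log_eval {d : ℕ} {Λ : Finset (Fin d → ℤ)} (hΛ : ∀ k ∈ Λ, -k ∈ Λ)
    {q : (Fin d → ℤ) → ℂ} (hq : q ∈ Pbar d Λ) (hq0 : q ≠ 0) :
    Integrable (fun θ => Real.log (eval d Λ q θ)) (dm d) := by
  obtain ⟨k, hk, hqk⟩ := exists_coeff_ne_zero hq.1 hq0
  refine integrable_dm_of_integrableOn ⟨?_, ?_⟩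
  · exact (Real.measurable_log.comp (continuous_eval d Λ q).measurable).aestronglyMeasurable
  · refine lt_of_le_of_lt (lintegral_mono fun θ => ?_)
      (lintegral_absLogNorm_expSum_lt_top hk hqk)
    rw [← ofReal_eval hΛ hq.1, absLogNorm]
    split_ifs with h
    · exact le_top
    · rw [Real.enorm_eq_ofReal_abs, Complex.norm_real, Real.norm_eq_abs, Real.log_abs]

lemma integrable_eval_mul_log_div {d : ℕ} {Λ : Finset (Fin d → ℤ)} (hΛ : ∀ k ∈ Λ, -k ∈ Λ)
    (p : (Fin d → ℤ) → ℂ) {q : (Fin d → ℤ) → ℂ} (hq : q ∈ Pbar d Λ) (hq0 : q ≠ 0) :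
    Integrable (fun θ => eval d Λ p θ * Real.log (eval d Λ p θ / eval d Λ q θ)) (dm d) := by
  have h1 : Integrable (fun θ => eval d Λ p θ * Real.log (eval d Λ p θ)) (dm d) :=
    integrable_dm_of_integrableOn
      (integrableOn_Td_of_continuous (Real.continuous_mul_log.comp (continuous_eval d Λ p)))
  have h2 : Integrable (fun θ => eval d Λ p θ * Real.log (eval d Λ q θ)) (dm d) := by
    refine (integrable_log_eval hΛ hq hq0).bdd_mul (c := ∑ k ∈ Λ, ‖p k‖)
      (continuous_eval d Λ p).aestronglyMeasurable (Filter.Eventually.of_forall fun θ => ?_)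
    refine (Complex.abs_re_le_norm _).trans ?_
    change ‖expSum d Λ p θ‖ ≤ _
    rw [← torusSum_coe]
    exact norm_torusSum_le _ _ _ _
  refine (h1.sub h2).congr ?_
  filter_upwards [ae_eval_pos hΛ hq hq0] with θ hθ
  by_cases hp : eval d Λ p θ = 0
  · simp [hp]
  · simp only [Pi.sub_apply]
    rw [Real.log_div hp hθ.ne', mul_sub]

lemma le_mul_log_div {x y r : ℝ} (hx : 0 ≤ x) (hy : 0 < y) (hr : 0 < r) :
    x * Real.log r + x - r * y ≤ x * Real.log (x / y) := by
  rcases hx.eq_or_lt with rfl | hx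
  · simp only [zero_mul, zero_add, zero_sub, zero_div]
    exact neg_nonpos.2 (by positivity)
  · have h := Real.log_le_sub_one_of_pos (x := r * y / x) (by positivity)
    rw [Real.log_div (by positivity) hx.ne', Real.log_mul hr.ne' hy.ne'] at h
    have h' := mul_le_mul_of_nonneg_left h hx.le
    have h'' : x * (r * y / x - 1) = r * y - x := by field_simp
    rw [h''] at h'
    rw [Real.log_div hx.ne' hy.ne']
    linarith

/-- The log-sum inequality, i.e. joint convexity of `(x, y) ↦ x log (x / y)`. -/
lemma mul_log_div_convex {a b x₁ x₂ y₁ y₂ : ℝ} (ha : 0 ≤ a) (hb : 0 ≤ b) (hab : a + b = 1)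
    (hx₁ : 0 ≤ x₁) (hx₂ : 0 ≤ x₂) (hy₁ : 0 < y₁) (hy₂ : 0 < y₂) :
    (a * x₁ + b * x₂) * Real.log ((a * x₁ + b * x₂) / (a * y₁ + b * y₂)) ≤
      a * (x₁ * Real.log (x₁ / y₁)) + b * (x₂ * Real.log (x₂ / y₂)) := by
  have hY : 0 < a * y₁ + b * y₂ := convex_Ioi (0 : ℝ) hy₁ hy₂ ha hb hab
  have h₁ := mul_nonneg ha hx₁
  have h₂ := mul_nonneg hb hx₂
  rcases (add_nonneg h₁ h₂).eq_or_lt with hX | hX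
  · have e₁ : a * x₁ = 0 := by linarith
    have e₂ : b * x₂ = 0 := by linarith
    simp [← mul_assoc, e₁, e₂]
  · have hr := div_pos hX hY
    have k₁ := mul_le_mul_of_nonneg_left (le_mul_log_div hx₁ hy₁ hr) ha
    have k₂ := mul_le_mul_of_nonneg_left (le_mul_log_div hx₂ hy₂ hr) hb
    have hrY := div_mul_cancel₀ (a * x₁ + b * x₂) hY.ne'
    generalize (a * x₁ + b * x₂) / (a * y₁ + b * y₂) = r at *
    nlinarith

lemma eval_combo (d : ℕ) (Λ : Finset (Fin d → ℤ)) (p q : (Fin d → ℤ) → ℂ) (a b : ℝ)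
    (θ : Fin d → ℝ) :
    eval d Λ (a • p + b • q) θ = a * eval d Λ p θ + b * eval d Λ q θ := by
  simp only [eval, Complex.re_sum, Finset.mul_sum, ← Finset.sum_add_distrib]
  refine Finset.sum_congr rfl fun k _ => ?_
  simp only [Pi.add_apply, Pi.smul_apply, Complex.real_smul, add_mul, mul_assoc, Complex.add_re,
    Complex.re_ofReal_mul]

lemma pair_combo (d : ℕ) (Λ : Finset (Fin d → ℤ)) (c p q : (Fin d → ℤ) → ℂ) (a b : ℝ) :
    pair d Λ c (a • p + b • q) = a * pair d Λ c p + b * pair d Λ c q := by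
  simp only [pair, Complex.re_sum, Finset.mul_sum, ← Finset.sum_add_distrib]
  refine Finset.sum_congr rfl fun k _ => ?_
  simp only [Pi.add_apply, Pi.smul_apply, Complex.real_smul, map_add, map_mul, Complex.conj_ofReal,
    mul_add, mul_left_comm (c k), Complex.add_re, Complex.re_ofReal_mul]

lemma convex_Pbar (d : ℕ) (Λ : Finset (Fin d → ℤ)) : Convex ℝ (Pbar d Λ) := by
  intro p hp q hq a b ha hb _
  refine ⟨⟨fun k hk => ?_, fun k => ?_⟩, fun θ hθ => ?_⟩
  · simp [hp.1.1 k hk, hq.1.1 k hk]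
  · simp [hp.1.2 k, hq.1.2 k]
  · rw [eval_combo]
    exact add_nonneg (mul_nonneg ha (hp.2 θ hθ)) (mul_nonneg hb (hq.2 θ hθ))

lemma convex_Pbaro (d : ℕ) (Λ : Finset (Fin d → ℤ)) : Convex ℝ (Pbaro d Λ) := by
  intro p hp q hq a b ha hb hab
  refine ⟨convex_Pbar d Λ hp.1 hq.1 ha hb hab, ?_⟩
  simp only [Pi.add_apply, Pi.smul_apply, hp.2, hq.2, Complex.real_smul, mul_one]
  exact_mod_cast hab

lemma convex_Pbar_diff_zero {d : ℕ} {Λ : Finset (Fin d → ℤ)} {c : (Fin d → ℤ) → ℂ}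
    (hc : c ∈ Cplus d Λ) : Convex ℝ (Pbar d Λ \ {0}) := by
  intro p hp q hq a b ha hb hab
  refine ⟨convex_Pbar d Λ hp.1 hq.1 ha hb hab, fun h => ?_⟩
  have hpos : 0 < a * pair d Λ c p + b * pair d Λ c q :=
    convex_Ioi (0 : ℝ) (hc.2 p hp.1 hp.2) (hc.2 q hq.1 hq.2) ha hb hab
  rw [← pair_combo, mem_singleton_iff.1 h] at hpos
  simp [pair] at hpos

lemma J2_eq (d : ℕ) (Λ : Finset (Fin d → ℤ)) (c γ P Q : (Fin d → ℤ) → ℂ) :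
    J2 d Λ c γ P Q = pair d Λ c Q - pair d Λ γ P +
      ∫ θ, eval d Λ P θ * Real.log (eval d Λ P θ / eval d Λ Q θ) ∂(dm d) := by
  rw [J2]
  congr 2 with θ
  split_ifs with h <;> simp [h]

/-- the functional (P,Q) ↦ J(P,Q) is convex on the convex set
𝔓̄₊,∘ × (𝔓̄₊ \ {0}). -/
theorem statement17 (d : ℕ) (hd : 1 ≤ d) (Λ : Finset (Fin d → ℤ))
    (h0 : (0 : Fin d → ℤ) ∈ Λ) (hΛ : ∀ k ∈ Λ, -k ∈ Λ)
    (c γ : (Fin d → ℤ) → ℂ) (hc : c ∈ Cplus d Λ)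
    (hγ : IsCoeff d Λ γ) (hγ0 : γ 0 = 1) :
    ConvexOn ℝ (Pbaro d Λ ×ˢ (Pbar d Λ \ {0}))
      (fun PQ : ((Fin d → ℤ) → ℂ) × ((Fin d → ℤ) → ℂ) => J2 d Λ c γ PQ.1 PQ.2) := by
  refine ⟨(convex_Pbaro d Λ).prod (convex_Pbar_diff_zero hc), ?_⟩
  rintro ⟨P₁, Q₁⟩ ⟨hP₁, hQ₁⟩ ⟨P₂, Q₂⟩ ⟨hP₂, hQ₂⟩ a b ha hb hab
  have hQ : a • Q₁ + b • Q₂ ∈ Pbar d Λ \ {0} := convex_Pbar_diff_zero hc hQ₁ hQ₂ ha hb hab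
  have hint₁ := integrable_eval_mul_log_div hΛ P₁ hQ₁.1 hQ₁.2
  have hint₂ := integrable_eval_mul_log_div hΛ P₂ hQ₂.1 hQ₂.2
  have hle : ∫ θ, eval d Λ (a • P₁ + b • P₂) θ *
        Real.log (eval d Λ (a • P₁ + b • P₂) θ / eval d Λ (a • Q₁ + b • Q₂) θ) ∂(dm d) ≤
      a * (∫ θ, eval d Λ P₁ θ * Real.log (eval d Λ P₁ θ / eval d Λ Q₁ θ) ∂(dm d)) +
      b * (∫ θ, eval d Λ P₂ θ * Real.log (eval d Λ P₂ θ / eval d Λ Q₂ θ) ∂(dm d)) := by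
    rw [← integral_const_mul, ← integral_const_mul,
      ← integral_add (hint₁.const_mul a) (hint₂.const_mul b)]
    refine integral_mono_ae (integrable_eval_mul_log_div hΛ _ hQ.1 hQ.2)
      ((hint₁.const_mul a).add (hint₂.const_mul b)) ?_
    filter_upwards [ae_dm_of_forall_mem hP₁.1.2, ae_dm_of_forall_mem hP₂.1.2,
      ae_eval_pos hΛ hQ₁.1 hQ₁.2, ae_eval_pos hΛ hQ₂.1 hQ₂.2] with θ h₁ h₂ h₃ h₄
    simp only [eval_combo]
    exact mul_log_div_convex ha hb hab h₁ h₂ h₃ h₄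
  simp only [Prod.smul_mk, Prod.mk_add_mk, J2_eq, pair_combo, smul_eq_mul]
  linarith

end RCE
end
end

section
/- Let P ∈ 𝔓̄_+ \ {0} and c ∈ ℭ_+, and for every N = (N_1,…,N_d) with min_j N_j large enough that c ∈ ℭ_+(N), let Q̂_N be a minimizer of the discrete dual functional J_P^N over 𝔓̄_+(N). Then the family (Q̂_N) is bounded in L^∞(𝕋^d), i.e., sup_N ‖Q̂_N‖_∞ < ∞, where ‖Q‖_∞ := sup_{θ∈𝕋^d} |Q(e^{iθ})|. -/
open MeasureTheory Complex Set

noncomputable section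

namespace RCE

/-- The grid point θ_ℓ = (2π ℓ₁/N₁, …, 2π ℓ_d/N_d), so that ζ_ℓ = e^{iθ_ℓ}. -/
def gridθ (d : ℕ) (N : Fin d → ℕ) (L : (j : Fin d) → Fin (N j)) : Fin d → ℝ :=
  fun j => 2 * Real.pi * (L j : ℝ) / (N j : ℝ)

/-- Evaluation of the trigonometric polynomial at the grid point ζ_ℓ. -/
def evalG (d : ℕ) (Λ : Finset (Fin d → ℤ)) (p : (Fin d → ℤ) → ℂ) (N : Fin d → ℕ)
    (L : (j : Fin d) → Fin (N j)) : ℝ :=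
  eval d Λ p (gridθ d N L)

/-- `𝔓̄₊(N)` : polynomials nonnegative on the grid. -/
def PbarN (d : ℕ) (Λ : Finset (Fin d → ℤ)) (N : Fin d → ℕ) : Set ((Fin d → ℤ) → ℂ) :=
  {p | IsCoeff d Λ p ∧ ∀ L : (j : Fin d) → Fin (N j), 0 ≤ evalG d Λ p N L}

/-- `𝔓₊(N)` : polynomials positive on the grid. -/
def PplusN (d : ℕ) (Λ : Finset (Fin d → ℤ)) (N : Fin d → ℕ) : Set ((Fin d → ℤ) → ℂ) :=
  {p | IsCoeff d Λ p ∧ ∀ L : (j : Fin d) → Fin (N j), 0 < evalG d Λ p N L}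

/-- `ℭ₊(N)` : the interior of the dual cone of `𝔓̄₊(N)`. -/
def CplusN (d : ℕ) (Λ : Finset (Fin d → ℤ)) (N : Fin d → ℕ) : Set ((Fin d → ℤ) → ℂ) :=
  {c | IsCoeff d Λ c ∧ ∀ p ∈ PbarN d Λ N, p ≠ 0 → 0 < pair d Λ c p}

/-- The discrete dual functional J_P^N(Q) = ⟨c,q⟩ − (Π_j N_j)⁻¹ Σ_ℓ P(ζ_ℓ) log Q(ζ_ℓ),
with the convention P(ζ_ℓ) log Q(ζ_ℓ) := 0 whenever P(ζ_ℓ) = 0. -/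
def JN (d : ℕ) (Λ : Finset (Fin d → ℤ)) (N : Fin d → ℕ) (c P Q : (Fin d → ℤ) → ℂ) : ℝ :=
  pair d Λ c Q - (∏ j, (N j : ℝ))⁻¹ *
    ∑ L : (j : Fin d) → Fin (N j),
      (if evalG d Λ P N L = 0 then 0 else evalG d Λ P N L * Real.log (evalG d Λ Q N L))

/-- The effective domain of J_P^N on `𝔓̄₊(N) \ {0}` : those Q for which the (extended-real
valued) functional J_P^N(Q) is finite, i.e. Q(ζ_ℓ) ≠ 0 whenever P(ζ_ℓ) ≠ 0.  Minimizing
J_P^N over `𝔓̄₊(N)` is the same as minimizing it over this set. -/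
def domN (d : ℕ) (Λ : Finset (Fin d → ℤ)) (N : Fin d → ℕ) (P : (Fin d → ℤ) → ℂ) :
    Set ((Fin d → ℤ) → ℂ) :=
  {Q | Q ∈ PbarN d Λ N ∧ Q ≠ 0 ∧
    ∀ L : (j : Fin d) → Fin (N j), evalG d Λ P N L = 0 ∨ evalG d Λ Q N L ≠ 0}

/-- The `ℓ¹`-norm of the coefficients indexed by `Λ`. -/
def coeffNorm {d : ℕ} (Λ : Finset (Fin d → ℤ)) (p : (Fin d → ℤ) → ℂ) : ℝ := ∑ k ∈ Λ, ‖p k‖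

section

open Filter Topology

variable {d : ℕ} {Λ : Finset (Fin d → ℤ)}

lemma continuous_eval_s19 :
    Continuous fun x : ((Fin d → ℤ) → ℂ) × (Fin d → ℝ) => eval d Λ x.1 x.2 := by
  unfold eval dotP
  fun_prop

lemma continuous_pair (c : (Fin d → ℤ) → ℂ) : Continuous fun p => pair d Λ c p := by
  unfold pair
  fun_prop

lemma continuous_coeffNorm :
    Continuous fun p : (Fin d → ℤ) → ℂ => coeffNorm Λ p := by
  unfold coeffNorm
  fun_prop

lemma isClosed_isCoeff : IsClosed {p | IsCoeff d Λ p} := by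
  simp only [IsCoeff, ofPred_and, ofPred_forall]
  refine IsClosed.inter ?_ ?_
  · exact isClosed_iInter fun k => isClosed_iInter fun _ =>
      isClosed_eq (continuous_apply k) continuous_const
  · exact isClosed_iInter fun k =>
      isClosed_eq (continuous_apply (-k)) (Complex.continuous_conj.comp (continuous_apply k))

lemma coeffNorm_nonneg (p : (Fin d → ℤ) → ℂ) : 0 ≤ coeffNorm Λ p :=
  Finset.sum_nonneg fun _ _ => norm_nonneg _

lemma IsCoeff.eq_zero_of_coeffNorm {p : (Fin d → ℤ) → ℂ} (hp : IsCoeff d Λ p)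
    (h : coeffNorm Λ p = 0) : p = 0 := by
  funext k
  by_cases hk : k ∈ Λ
  · exact norm_eq_zero.1 ((Finset.sum_eq_zero_iff_of_nonneg fun _ _ => norm_nonneg _).1 h k hk)
  · exact hp.1 k hk

lemma abs_eval_le (p : (Fin d → ℤ) → ℂ) (θ : Fin d → ℝ) : |eval d Λ p θ| ≤ coeffNorm Λ p := by
  refine (Complex.abs_re_le_norm _).trans ((norm_sum_le _ _).trans (Finset.sum_le_sum fun k _ => ?_))
  rw [norm_mul, ← Complex.ofReal_neg, Complex.norm_exp_ofReal_mul_I, mul_one]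

lemma IsCoeff.smul {p : (Fin d → ℤ) → ℂ} (hp : IsCoeff d Λ p) (r : ℝ) :
    IsCoeff d Λ (r • p) := by
  refine ⟨fun k hk => by simp [hp.1 k hk], fun k => by simp [hp.2 k]⟩

lemma eval_smul (p : (Fin d → ℤ) → ℂ) (r : ℝ) (θ : Fin d → ℝ) :
    eval d Λ (r • p) θ = r * eval d Λ p θ := by
  unfold eval
  rw [← Complex.re_ofReal_mul, Finset.mul_sum]
  simp [mul_assoc]

lemma pair_smul (c p : (Fin d → ℤ) → ℂ) (r : ℝ) :
    pair d Λ c (r • p) = r * pair d Λ c p := by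
  unfold pair
  rw [← Complex.re_ofReal_mul, Finset.mul_sum]
  simp [mul_left_comm]

lemma coeffNorm_smul (p : (Fin d → ℤ) → ℂ) {r : ℝ} (hr : 0 ≤ r) :
    coeffNorm Λ (r • p) = r * coeffNorm Λ p := by
  simp [coeffNorm, Finset.mul_sum, abs_of_nonneg hr]

lemma smul_mem_PbarN {N : Fin d → ℕ} {p : (Fin d → ℤ) → ℂ} (hp : p ∈ PbarN d Λ N)
    {r : ℝ} (hr : 0 ≤ r) : r • p ∈ PbarN d Λ N := by
  refine ⟨hp.1.smul r, fun L => ?_⟩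
  rw [evalG, eval_smul]
  exact mul_nonneg hr (hp.2 L)

/-- Nonnegativity on `𝕋^d` propagates to all of `ℝ^d` by periodicity. -/
lemma eval_nonneg_of_mem_Pbar {p : (Fin d → ℤ) → ℂ} (hp : p ∈ Pbar d Λ) (θ : Fin d → ℝ) :
    0 ≤ eval d Λ p θ := by
  have hpi := Real.two_pi_pos
  let φ : Fin d → ℝ := fun j => toIocMod hpi (-Real.pi) (θ j)
  have hφ : φ ∈ Td d := fun j _ => by
    have := toIocMod_mem_Ioc hpi (-Real.pi) (θ j)
    rwa [show -Real.pi + 2 * Real.pi = Real.pi by ring] at this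
  convert hp.2 φ hφ using 1
  unfold eval
  congr 1
  refine Finset.sum_congr rfl fun k _ => ?_
  congr 1
  rw [Complex.exp_eq_exp_iff_exists_int]
  refine ⟨-∑ j, k j * toIocDiv hpi (-Real.pi) (θ j), ?_⟩
  have hdot : dotP d k θ = dotP d k φ +
      (∑ j, k j * toIocDiv hpi (-Real.pi) (θ j) : ℤ) * (2 * Real.pi) := by
    unfold dotP
    push_cast
    rw [Finset.sum_mul, ← Finset.sum_add_distrib]
    refine Finset.sum_congr rfl fun j _ => ?_
    have := toIocMod_add_toIocDiv_zsmul hpi (-Real.pi) (θ j)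
    rw [zsmul_eq_mul] at this
    simp only [φ]
    linear_combination (-(k j : ℝ)) * this
  rw [hdot]
  push_cast
  ring

lemma isCoeff_one (h0 : (0 : Fin d → ℤ) ∈ Λ) : IsCoeff d Λ (Pi.single 0 1) := by
  refine ⟨fun k hk => Pi.single_eq_of_ne (by rintro rfl; exact hk h0) _, fun k => ?_⟩
  by_cases hk : k = 0
  · simp [hk]
  · rw [Pi.single_eq_of_ne (neg_ne_zero.2 hk), Pi.single_eq_of_ne hk, map_zero]

lemma eval_one (h0 : (0 : Fin d → ℤ) ∈ Λ) (θ : Fin d → ℝ) :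
    eval d Λ (Pi.single 0 1) θ = 1 := by
  unfold eval
  rw [Finset.sum_eq_single_of_mem 0 h0 fun k _ hk => by rw [Pi.single_eq_of_ne hk, zero_mul]]
  simp [dotP]

lemma one_mem_domN (h0 : (0 : Fin d → ℤ) ∈ Λ) (N : Fin d → ℕ) (P : (Fin d → ℤ) → ℂ) :
    Pi.single 0 1 ∈ domN d Λ N P := by
  refine ⟨⟨isCoeff_one h0, fun L => ?_⟩, by simp, fun L => Or.inr ?_⟩ <;>
    simp [evalG, eval_one h0]

lemma JN_one (h0 : (0 : Fin d → ℤ) ∈ Λ) (N : Fin d → ℕ) (c P : (Fin d → ℤ) → ℂ) :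
    JN d Λ N c P (Pi.single 0 1) = pair d Λ c (Pi.single 0 1) := by
  simp [JN, evalG, eval_one h0]

/-- The dual cone of an empty grid has no interior. -/
lemma pos_of_mem_CplusN (h0 : (0 : Fin d → ℤ) ∈ Λ) {c : (Fin d → ℤ) → ℂ} {N : Fin d → ℕ}
    (hc : c ∈ CplusN d Λ N) (j : Fin d) : 0 < N j := by
  by_contra hj
  have hempty : ∀ L : (j : Fin d) → Fin (N j), False := fun L => by have := (L j).2; omega
  have h1 := hc.2 (Pi.single 0 1) ⟨isCoeff_one h0, fun L => (hempty L).elim⟩ (by simp)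
  have h2 := hc.2 ((-1 : ℝ) • Pi.single 0 1) ⟨(isCoeff_one h0).smul _, fun L => (hempty L).elim⟩
    (by simp)
  rw [pair_smul] at h2
  linarith

lemma ultrafilter_eventually_eq_or_tendsto_atTop {ι : Type*} (U : Ultrafilter ι) (f : ι → ℕ) :
    (∃ m, ∀ᶠ i in (U : Filter ι), f i = m) ∨ Tendsto f U atTop := by
  by_cases h : ∃ m, ∀ᶠ i in (U : Filter ι), f i = m
  · exact Or.inl h
  · refine Or.inr (tendsto_atTop.2 fun b => ?_)
    have hne : ∀ m, ∀ᶠ i in (U : Filter ι), f i ≠ m := fun m =>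
      Ultrafilter.eventually_not.2 fun hm => h ⟨m, hm⟩
    have hall : ∀ᶠ i in (U : Filter ι), ∀ m ∈ Finset.range b, f i ≠ m :=
      (Filter.eventually_all_finset _).2 fun m _ => hne m
    filter_upwards [hall] with i hi
    by_contra hlt
    exact hi (f i) (Finset.mem_range.2 (not_le.1 hlt)) rfl

/-- Along an ultrafilter the grids indexed by `N i`, with `N i ≥ N₀`, asymptotically contain some
fixed grid indexed by `M ≥ N₀`. -/
lemma exists_grid_limit {ι : Type*} (U : Ultrafilter ι) {N₀ : ℕ} (hN₀ : 0 < N₀)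
    (N : ι → Fin d → ℕ) (hN : ∀ i j, N₀ ≤ N i j) :
    ∃ M : Fin d → ℕ, (∀ j, N₀ ≤ M j) ∧ ∀ L : (j : Fin d) → Fin (M j),
      ∃ L' : ∀ i, (j : Fin d) → Fin (N i j),
        Tendsto (fun i => gridθ d (N i) (L' i)) U (𝓝 (gridθ d M L)) := by
  have key : ∀ j, ∃ m, N₀ ≤ m ∧
      ((∀ᶠ i in (U : Filter ι), N i j = m) ∨ Tendsto (fun i => N i j) U atTop) := fun j => by
    rcases ultrafilter_eventually_eq_or_tendsto_atTop U fun i => N i j with ⟨m, hm⟩ | h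
    · obtain ⟨i, hi⟩ := hm.exists
      exact ⟨m, hi ▸ hN i j, Or.inl hm⟩
    · exact ⟨N₀, le_rfl, Or.inr h⟩
  choose M hM hMU using key
  refine ⟨M, hM, fun L => ?_⟩
  have hMpos : ∀ j, (0 : ℝ) < M j := fun j => by exact_mod_cast hN₀.trans_le (hM j)
  have hNpos : ∀ i j, (0 : ℝ) < N i j := fun i j => by exact_mod_cast hN₀.trans_le (hN i j)
  have ha : ∀ j, (0 : ℝ) ≤ (L j : ℝ) / M j := fun j => by positivity
  have hlt : ∀ i j, ⌊(L j : ℝ) / M j * N i j⌋₊ < N i j := fun i j => by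
    rw [Nat.floor_lt (mul_nonneg (ha j) (hNpos i j).le)]
    refine mul_lt_of_lt_one_left (hNpos i j) ?_
    rw [div_lt_one (hMpos j)]
    exact_mod_cast (L j).2
  refine ⟨fun i j => ⟨_, hlt i j⟩, tendsto_pi_nhds.2 fun j => ?_⟩
  simp only [gridθ, mul_div_assoc]
  refine Tendsto.const_mul (2 * Real.pi) ?_
  rcases hMU j with h | h
  · refine tendsto_const_nhds.congr' ?_
    filter_upwards [h] with i hi
    rw [hi, div_mul_cancel₀ _ (hMpos j).ne', Nat.floor_natCast]
  · exact (tendsto_nat_floor_mul_div_atTop (ha j)).comp (tendsto_natCast_atTop_atTop.comp h)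

/-- If `c` is in the interior of the dual cone for all sufficiently fine grids, then the pairing
with `c` is coercive uniformly in the grid. -/
lemma exists_uniform_coercive {N₀ : ℕ} (hN₀ : 0 < N₀)
    {c : (Fin d → ℤ) → ℂ} (hc : ∀ N : Fin d → ℕ, (∀ j, N₀ ≤ N j) → c ∈ CplusN d Λ N) :
    ∃ ε > 0, ∀ N : Fin d → ℕ, (∀ j, N₀ ≤ N j) → ∀ q ∈ PbarN d Λ N,
      ε * coeffNorm Λ q ≤ pair d Λ c q := by
  by_contra! hcon
  have hunit : ∀ n : ℕ, ∃ N : Fin d → ℕ, (∀ j, N₀ ≤ N j) ∧ ∃ q ∈ PbarN d Λ N,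
      coeffNorm Λ q = 1 ∧ pair d Λ c q < 1 / ((n : ℝ) + 1) := fun n => by
    obtain ⟨N, hN, q, hq, hlt⟩ := hcon (1 / ((n : ℝ) + 1)) Nat.one_div_pos_of_nat
    have hpos : 0 < coeffNorm Λ q := by
      refine (coeffNorm_nonneg q).lt_of_ne' fun h => ?_
      rw [hq.1.eq_zero_of_coeffNorm h] at hlt
      simp [pair, coeffNorm] at hlt
    refine ⟨N, hN, (coeffNorm Λ q)⁻¹ • q, smul_mem_PbarN hq (inv_nonneg.2 hpos.le), ?_, ?_⟩
    · rw [coeffNorm_smul _ (inv_nonneg.2 hpos.le), inv_mul_cancel₀ hpos.ne']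
    · rw [pair_smul, inv_mul_lt_iff₀ hpos, mul_comm]
      exact hlt
  choose N hN q hq hq1 hqc using hunit
  let U : Ultrafilter ℕ := hyperfilter ℕ
  have hU : (U : Filter ℕ) ≤ atTop := Nat.hyperfilter_le_atTop
  have hK : IsCompact (Set.univ.pi fun _ : Fin d → ℤ => Metric.closedBall (0 : ℂ) 1) :=
    isCompact_univ_pi fun _ => isCompact_closedBall 0 1
  have hqK : ∀ n, q n ∈ Set.univ.pi fun _ : Fin d → ℤ => Metric.closedBall (0 : ℂ) 1 := by
    intro n k _
    rw [mem_closedBall_zero_iff]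
    by_cases hk : k ∈ Λ
    · rw [← hq1 n]
      exact Finset.single_le_sum (f := fun k => ‖q n k‖) (fun _ _ => norm_nonneg _) hk
    · simp [(hq n).1.1 k hk]
  obtain ⟨r, -, hr⟩ := hK.ultrafilter_le_nhds' (U.map q)
    (Ultrafilter.mem_map.2 (Eventually.of_forall hqK))
  have hr : Tendsto q U (𝓝 r) := hr
  obtain ⟨M, hM, hgrid⟩ := exists_grid_limit U hN₀ N hN
  have hrcoeff : IsCoeff d Λ r :=
    isClosed_isCoeff.mem_of_tendsto hr (Eventually.of_forall fun n => (hq n).1)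
  have hrM : r ∈ PbarN d Λ M := by
    refine ⟨hrcoeff, fun L => ?_⟩
    obtain ⟨L', hL'⟩ := hgrid L
    exact ge_of_tendsto' ((continuous_eval_s19.tendsto (r, gridθ d M L)).comp (hr.prodMk_nhds hL'))
      fun n => (hq n).2 (L' n)
  have hr1 : coeffNorm Λ r = 1 :=
    tendsto_nhds_unique ((continuous_coeffNorm.tendsto r).comp hr)
      (tendsto_const_nhds.congr fun n => (hq1 n).symm)
  have hr0 : r ≠ 0 := by
    rintro rfl
    simp [coeffNorm] at hr1
  have hle : pair d Λ c r ≤ 0 :=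
    le_of_tendsto_of_tendsto' (((continuous_pair c).tendsto r).comp hr)
      (tendsto_one_div_add_atTop_nhds_zero_nat.mono_left hU) fun n => (hqc n).le
  exact hle.not_gt ((hc M hM).2 r hrM hr0)

lemma log_le_mul_add_abs_log {δ x : ℝ} (hδ : 0 < δ) (hx : 0 ≤ x) :
    Real.log x ≤ δ * x + |Real.log δ| := by
  rcases hx.eq_or_lt with rfl | hx
  · simp
  · have h := Real.log_le_sub_one_of_pos (mul_pos hδ hx)
    rw [Real.log_mul hδ.ne' hx.ne'] at h
    linarith [neg_abs_le (Real.log δ)]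

/-- Lower bound for the discrete dual functional. -/
lemma pair_sub_le_JN {N : Fin d → ℕ} (hN : ∀ j, 0 < N j) {c P Q : (Fin d → ℤ) → ℂ}
    (hP : P ∈ Pbar d Λ) (hQ : Q ∈ PbarN d Λ N) {δ : ℝ} (hδ : 0 < δ) :
    pair d Λ c Q - coeffNorm Λ P * (δ * coeffNorm Λ Q + |Real.log δ|) ≤ JN d Λ N c P Q := by
  have hprod : (0 : ℝ) < ∏ j, (N j : ℝ) := Finset.prod_pos fun j _ => by exact_mod_cast hN j
  unfold JN
  refine sub_le_sub_left ?_ _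
  rw [inv_mul_le_iff₀ hprod]
  refine (Finset.sum_le_card_nsmul _ _
    (coeffNorm Λ P * (δ * coeffNorm Λ Q + |Real.log δ|)) fun L _ => ?_).trans_eq ?_
  · have hbound : 0 ≤ δ * coeffNorm Λ Q + |Real.log δ| :=
      add_nonneg (mul_nonneg hδ.le (coeffNorm_nonneg Q)) (abs_nonneg _)
    split_ifs
    · exact mul_nonneg (coeffNorm_nonneg P) hbound
    · calc evalG d Λ P N L * Real.log (evalG d Λ Q N L)
          ≤ evalG d Λ P N L * (δ * coeffNorm Λ Q + |Real.log δ|) := by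
            refine mul_le_mul_of_nonneg_left ?_ (eval_nonneg_of_mem_Pbar hP _)
            refine (log_le_mul_add_abs_log hδ (hQ.2 L)).trans ?_
            gcongr
            exact (le_abs_self _).trans (abs_eval_le _ _)
        _ ≤ coeffNorm Λ P * (δ * coeffNorm Λ Q + |Real.log δ|) := by
            gcongr
            exact (le_abs_self _).trans (abs_eval_le _ _)
  · simp

end

/-- given P ∈ 𝔓̄₊ \ {0}, c ∈ ℭ₊ and, for every N with minⱼ Nⱼ large
enough (so that c ∈ ℭ₊(N)), a minimizer Q̂_N of the discrete dual functional J_P^N over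
𝔓̄₊(N), the family (Q̂_N) is bounded in L^∞(𝕋^d). -/
theorem statement19 (d : ℕ) (hd : 1 ≤ d) (Λ : Finset (Fin d → ℤ))
    (h0 : (0 : Fin d → ℤ) ∈ Λ) (hΛ : ∀ k ∈ Λ, -k ∈ Λ)
    (c P : (Fin d → ℤ) → ℂ) (hc : c ∈ Cplus d Λ) (hP : P ∈ Pbar d Λ \ {0})
    (QN : (Fin d → ℕ) → ((Fin d → ℤ) → ℂ)) (N₀ : ℕ)
    (hQN : ∀ N : Fin d → ℕ, (∀ j, N₀ ≤ N j) →
      c ∈ CplusN d Λ N ∧ QN N ∈ domN d Λ N P ∧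
        ∀ Q ∈ domN d Λ N P, JN d Λ N c P (QN N) ≤ JN d Λ N c P Q) :
    ∃ B : ℝ, ∀ N : Fin d → ℕ, (∀ j, N₀ ≤ N j) →
      ∀ θ ∈ Td d, |eval d Λ (QN N) θ| ≤ B := by
  have hN₀ : 0 < N₀ := pos_of_mem_CplusN h0 (hQN (fun _ => N₀) fun _ => le_rfl).1 ⟨0, hd⟩
  obtain ⟨ε, hε, hcoer⟩ := exists_uniform_coercive hN₀ fun N hN => (hQN N hN).1
  have hA : 0 < coeffNorm Λ P + 1 := by linarith [coeffNorm_nonneg (Λ := Λ) P]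
  let δ : ℝ := ε / (2 * (coeffNorm Λ P + 1))
  have hδ : 0 < δ := by positivity
  have hAδ : coeffNorm Λ P * δ ≤ ε / 2 := by
    have h : (coeffNorm Λ P + 1) * δ = ε / 2 := by
      simp only [δ]
      field_simp
    linarith
  refine ⟨2 / ε * (pair d Λ c (Pi.single 0 1) + coeffNorm Λ P * |Real.log δ|),
    fun N hN θ _ => (abs_eval_le _ _).trans ?_⟩
  obtain ⟨-, hdom, hmin⟩ := hQN N hN
  have h1 := hmin _ (one_mem_domN h0 N P)
  rw [JN_one h0] at h1
  have h2 := pair_sub_le_JN (c := c) (fun j => hN₀.trans_le (hN j)) hP.1 hdom.1 hδ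
  have h3 := hcoer N hN _ hdom.1
  have h4 := mul_le_mul_of_nonneg_right hAδ (coeffNorm_nonneg (Λ := Λ) (QN N))
  rw [div_mul_eq_mul_div, le_div_iff₀ hε]
  linarith

end RCE
end
end
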